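/- Let G = (V,E) be a digraph and a, b ∈ V with (a→b) ∈ E. Then π^{[a,b]} defines a morphism of chain complexes Θ_n^{[a,b]}(G) → Π̃_{n-2}(G) into the augmented primitive path chain complex, inducing homomorphisms H_n^{[a,b]}(G) → H̃_{n-2}(G) to reduced primitive path homology. -/

import Mathlib

noncomputable section

namespace PrimitivePath

/-- A simple digraph: arrows between distinct vertices. -/
structure SDigraph (V : Type) where
  Adj : V → V → Prop
  loopless : ∀ v, ¬ Adj v v

section

variable (R V : Type) [CommRing R] [DecidableEq V]

/-- `Chain R V n` is the free `R`-module `Λ_n(V,R)` on elementary `n`-paths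
(sequences of `n+1` vertices). -/
abbrev Chain (n : ℕ) : Type _ := (Fin (n + 1) → V) →₀ R

/-- An elementary path is allowed if consecutive vertices are joined by arrows. -/
def IsAllowed {V : Type} (G : SDigraph V) {n : ℕ} (p : Fin (n + 1) → V) : Prop :=
  ∀ i : Fin n, G.Adj (p i.castSucc) (p i.succ)

/-- An elementary path is regular if it has no two equal consecutive vertices. -/
def IsRegular {V : Type} {n : ℕ} (p : Fin (n + 1) → V) : Prop :=
  ∀ i : Fin n, p i.castSucc ≠ p i.succ

instance {n : ℕ} (p : Fin (n + 1) → V) : Decidable (IsRegular p) :=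
  inferInstanceAs (Decidable (∀ i : Fin n, p i.castSucc ≠ p i.succ))

/-- The differential `∂ : Λ_{n+1} → Λ_n`, alternating sum of vertex deletions. -/
def boundary (n : ℕ) : Chain R V (n + 1) →ₗ[R] Chain R V n :=
  Finsupp.lsum R fun p => ∑ m : Fin (n + 2),
    ((-1 : R) ^ (m : ℕ)) • Finsupp.lsingle (fun i : Fin (n + 1) => p (m.succAbove i))

/-- The `m`-th face map `∂^m : Λ_{n+1} → Λ_n`, deleting the `m`-th vertex. -/
def faceMap (n : ℕ) (m : Fin (n + 2)) : Chain R V (n + 1) →ₗ[R] Chain R V n :=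
  Finsupp.lsum R fun p => Finsupp.lsingle (fun i : Fin (n + 1) => p (m.succAbove i))

/-- The submodule of chains all of whose elementary paths satisfy `P`. -/
def pathsWith {n : ℕ} (P : (Fin (n + 1) → V) → Prop) : Submodule R (Chain R V n) where
  carrier := {w | ∀ p ∈ w.support, P p}
  add_mem' := by
    intro x y hx hy p hp
    rcases Finset.mem_union.1 (Finsupp.support_add hp) with h | h
    · exact hx p h
    · exact hy p h
  zero_mem' := by intro p hp; simp at hp
  smul_mem' := by intro c x hx p hp; exact hx p (Finsupp.support_smul hp)

/-- `A_n(G)`: the submodule of allowed chains. -/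
def allowedChains (G : SDigraph V) (n : ℕ) : Submodule R (Chain R V n) :=
  pathsWith R V (fun p => IsAllowed G p)

/-- Chains all of whose elementary paths have tail vertex `a`. -/
def tailSet (a : V) (n : ℕ) : Submodule R (Chain R V n) :=
  pathsWith R V (fun p => p 0 = a)

/-- Chains all of whose elementary paths have head vertex `b`. -/
def headSet (b : V) (n : ℕ) : Submodule R (Chain R V n) :=
  pathsWith R V (fun p => p (Fin.last n) = b)

/-- Chains all of whose elementary paths have tail `a` and head `b`
(the `(a,b)`-cluster module `Λ_n^{[a,b]}`). -/
def clusterSet (a b : V) (n : ℕ) : Submodule R (Chain R V n) :=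
  pathsWith R V (fun p => p 0 = a ∧ p (Fin.last n) = b)

/-- Projection killing the irregular elementary paths, modelling `Λ_n → R_n = Λ_n/I_n`. -/
def regProj (n : ℕ) : Chain R V n →ₗ[R] Chain R V n :=
  Finsupp.lsum R fun p => if IsRegular p then Finsupp.lsingle p else 0

/-- The `(a,b)`-cluster component `w ↦ w^{[a,b]}`. -/
def clusterComp (a b : V) (n : ℕ) : Chain R V n →ₗ[R] Chain R V n :=
  Finsupp.lsum R fun p =>
    if p 0 = a ∧ p (Fin.last n) = b then Finsupp.lsingle p else 0

/-- The `a`-tail component `w ↦ w^{[a,·]}`. -/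
def tailComp (a : V) (n : ℕ) : Chain R V n →ₗ[R] Chain R V n :=
  Finsupp.lsum R fun p => if p 0 = a then Finsupp.lsingle p else 0

/-- The `b`-head component `w ↦ w^{[·,b]}`. -/
def headComp (b : V) (n : ℕ) : Chain R V n →ₗ[R] Chain R V n :=
  Finsupp.lsum R fun p => if p (Fin.last n) = b then Finsupp.lsingle p else 0

/-- `Π_n(G)`: the primitive path chain modules. -/
def piChains (G : SDigraph V) : (n : ℕ) → Submodule R (Chain R V n)
  | 0 => allowedChains R V G 0
  | n + 1 =>
      allowedChains R V G (n + 1) ⊓ (allowedChains R V G n).comap (boundary R V n)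

/-- `Ω_n(G)`: the path chain modules (differential taken modulo irregular paths). -/
def omegaChains (G : SDigraph V) : (n : ℕ) → Submodule R (Chain R V n)
  | 0 => allowedChains R V G 0
  | n + 1 =>
      allowedChains R V G (n + 1) ⊓
        (allowedChains R V G n).comap ((regProj R V n).comp (boundary R V n))

/-- Cycles of the primitive path chain complex. -/
def piCycles (G : SDigraph V) : (n : ℕ) → Submodule R (Chain R V n)
  | 0 => piChains R V G 0
  | n + 1 => piChains R V G (n + 1) ⊓ LinearMap.ker (boundary R V n)

/-- Boundaries of the primitive path chain complex. -/
def piBoundaries (G : SDigraph V) (n : ℕ) : Submodule R (Chain R V n) :=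
  (piChains R V G (n + 1)).map (boundary R V n)

/-- Primitive path homology `H_n(Π_*(G))`: the image of the cycles in the
quotient by the boundaries. -/
abbrev piHomology (G : SDigraph V) (n : ℕ) : Type _ :=
  ↥((piCycles R V G n).map (piBoundaries R V G n).mkQ)

/-- Cycles of the path chain complex `Ω_*`. -/
def omegaCycles (G : SDigraph V) : (n : ℕ) → Submodule R (Chain R V n)
  | 0 => omegaChains R V G 0
  | n + 1 => omegaChains R V G (n + 1) ⊓ LinearMap.ker ((regProj R V n).comp (boundary R V n))

/-- Boundaries of the path chain complex `Ω_*`. -/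
def omegaBoundaries (G : SDigraph V) (n : ℕ) : Submodule R (Chain R V n) :=
  (omegaChains R V G (n + 1)).map ((regProj R V n).comp (boundary R V n))

/-- Path homology `H_n(Ω_*(G))`. -/
abbrev omegaHomology (G : SDigraph V) (n : ℕ) : Type _ :=
  ↥((omegaCycles R V G n).map (omegaBoundaries R V G n).mkQ)

/-- The cluster differential `d : Λ_{n+2}^{[a,b]} → Λ_{n+1}^{[a,b]}`
(alternating deletion of interior vertices only). -/
def clusterBoundary (n : ℕ) : Chain R V (n + 2) →ₗ[R] Chain R V (n + 1) :=
  Finsupp.lsum R fun p => ∑ m : Fin (n + 1),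
    ((-1 : R) ^ (m : ℕ)) •
      Finsupp.lsingle (fun i : Fin (n + 2) => p (m.succ.castSucc.succAbove i))

/-- `π^{[a,b]}` in degrees `≥ 2`: delete the two end vertices. -/
def stripEnds (n : ℕ) : Chain R V (n + 2) →ₗ[R] Chain R V n :=
  Finsupp.lsum R fun p => Finsupp.lsingle (fun i : Fin (n + 1) => p i.succ.castSucc)

/-- The sum-of-coefficients map (augmentation when `n = 0`). -/
def totalCoeff (n : ℕ) : Chain R V n →ₗ[R] R :=
  Finsupp.lsum R fun _ => LinearMap.id

/-- `A_n^{[a,b]}(G)`: allowed `(a,b)`-cluster chains. -/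
def allowedCluster (G : SDigraph V) (a b : V) (n : ℕ) : Submodule R (Chain R V n) :=
  allowedChains R V G n ⊓ clusterSet R V a b n

/-- `Θ_n^{[a,b]}(G)`. -/
def thetaChains (G : SDigraph V) (a b : V) : (n : ℕ) → Submodule R (Chain R V n)
  | 0 => ⊥
  | 1 => allowedCluster R V G a b 1
  | n + 2 =>
      allowedCluster R V G a b (n + 2) ⊓
        (allowedCluster R V G a b (n + 1)).comap (clusterBoundary R V n)

def thetaCycles (G : SDigraph V) (a b : V) : (n : ℕ) → Submodule R (Chain R V n)
  | 0 => ⊥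
  | 1 => thetaChains R V G a b 1
  | n + 2 => thetaChains R V G a b (n + 2) ⊓ LinearMap.ker (clusterBoundary R V n)

def thetaBoundaries (G : SDigraph V) (a b : V) : (n : ℕ) → Submodule R (Chain R V n)
  | 0 => ⊥
  | n + 1 => (thetaChains R V G a b (n + 2)).map (clusterBoundary R V n)

/-- Primitive `(a,b)`-cluster homology `H_n^{[a,b]}(G)`. -/
abbrev thetaHomology (G : SDigraph V) (a b : V) (n : ℕ) : Type _ :=
  ↥((thetaCycles R V G a b n).map (thetaBoundaries R V G a b n).mkQ)

/-- The tail differential `d^t` (never deleting the tail vertex). -/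
def tailBoundary (n : ℕ) : Chain R V (n + 1) →ₗ[R] Chain R V n :=
  Finsupp.lsum R fun p => ∑ m : Fin (n + 1),
    ((-1 : R) ^ (m : ℕ)) • Finsupp.lsingle (fun i : Fin (n + 1) => p (m.succ.succAbove i))

/-- The head differential `d^h` (never deleting the head vertex). -/
def headBoundary (n : ℕ) : Chain R V (n + 1) →ₗ[R] Chain R V n :=
  Finsupp.lsum R fun p => ∑ m : Fin (n + 1),
    ((-1 : R) ^ (m : ℕ)) • Finsupp.lsingle (fun i : Fin (n + 1) => p (m.castSucc.succAbove i))

/-- `π^{[a,·]}` in degrees `≥ 1`: delete the first vertex. -/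
def stripHead (n : ℕ) : Chain R V (n + 1) →ₗ[R] Chain R V n :=
  Finsupp.lsum R fun p => Finsupp.lsingle (fun i : Fin (n + 1) => p i.succ)

/-- `π^{[·,a]}` in degrees `≥ 1`: delete the last vertex. -/
def stripLast (n : ℕ) : Chain R V (n + 1) →ₗ[R] Chain R V n :=
  Finsupp.lsum R fun p => Finsupp.lsingle (fun i : Fin (n + 1) => p i.castSucc)

/-- `A_n^{[a,·]}(G)`: allowed chains with tail `a`. -/
def allowedTail (G : SDigraph V) (a : V) (n : ℕ) : Submodule R (Chain R V n) :=
  allowedChains R V G n ⊓ tailSet R V a n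

/-- `A_n^{[·,a]}(G)`: allowed chains with head `a`. -/
def allowedHead (G : SDigraph V) (a : V) (n : ℕ) : Submodule R (Chain R V n) :=
  allowedChains R V G n ⊓ headSet R V a n

/-- `Θ_n^{[a,·]}(G)`. -/
def tailTheta (G : SDigraph V) (a : V) : (n : ℕ) → Submodule R (Chain R V n)
  | 0 => allowedTail R V G a 0
  | n + 1 =>
      allowedTail R V G a (n + 1) ⊓ (allowedTail R V G a n).comap (tailBoundary R V n)

/-- `Θ_n^{[·,a]}(G)`. -/
def headTheta (G : SDigraph V) (a : V) : (n : ℕ) → Submodule R (Chain R V n)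
  | 0 => allowedHead R V G a 0
  | n + 1 =>
      allowedHead R V G a (n + 1) ⊓ (allowedHead R V G a n).comap (headBoundary R V n)

def tailCycles (G : SDigraph V) (a : V) : (n : ℕ) → Submodule R (Chain R V n)
  | 0 => tailTheta R V G a 0
  | n + 1 => tailTheta R V G a (n + 1) ⊓ LinearMap.ker (tailBoundary R V n)

def tailBoundaries (G : SDigraph V) (a : V) (n : ℕ) : Submodule R (Chain R V n) :=
  (tailTheta R V G a (n + 1)).map (tailBoundary R V n)

/-- Primitive `a`-tail homology `H_n^{[a,·]}(G)`. -/
abbrev tailHomology (G : SDigraph V) (a : V) (n : ℕ) : Type _ :=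
  ↥((tailCycles R V G a n).map (tailBoundaries R V G a n).mkQ)

/-- The path-reversal map with sign `(-1)^{n(n+1)/2}`. -/
def revMap (n : ℕ) : Chain R V n →ₗ[R] Chain R V n :=
  Finsupp.lsum R fun p =>
    ((-1 : R) ^ (n * (n + 1) / 2)) • Finsupp.lsingle (fun i : Fin (n + 1) => p i.rev)

end

/-- The inverse directed digraph: all arrows reversed. -/
def SDigraph.reverse {V : Type} (G : SDigraph V) : SDigraph V where
  Adj v w := G.Adj w v
  loopless v h := G.loopless v h

section

variable (R : Type) [CommRing R] (V W : Type) [DecidableEq V] [DecidableEq W]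

/-- The chain map `f_♯` induced by a vertex map: elementary paths go to their image
when regular, and to `0` otherwise. -/
def chainMap (f : V → W) (n : ℕ) : Chain R V n →ₗ[R] Chain R W n :=
  Finsupp.lsum R fun p =>
    if IsRegular (fun i => f (p i)) then Finsupp.lsingle (fun i => f (p i)) else 0

end

/-- A digraph is asymmetric if it has no symmetric pair of arrows. -/
def SDigraph.Asymmetric {V : Type} (G : SDigraph V) : Prop :=
  ∀ v w, G.Adj v w → ¬ G.Adj w v


section

variable (R V : Type) [CommRing R] [DecidableEq V]

/-- Deleting the end vertices intertwines the cluster differential with the boundary. -/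
theorem stripEnds_clusterBoundary (k : ℕ) (w : Chain R V (k + 3)) :
    stripEnds R V k (clusterBoundary R V (k + 1) w) =
      boundary R V k (stripEnds R V (k + 1) w) := by
  have h : (stripEnds R V k).comp (clusterBoundary R V (k + 1)) =
      (boundary R V k).comp (stripEnds R V (k + 1)) := by
    refine Finsupp.lhom_ext fun p r => ?_
    simp only [LinearMap.comp_apply, stripEnds, clusterBoundary, boundary, Finsupp.lsum_single,
      LinearMap.sum_apply, LinearMap.smul_apply, Finsupp.lsingle_apply, map_sum, map_smul]
    refine Finset.sum_congr rfl fun m _ => ?_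
    congr 2
    funext i
    rw [Fin.castSucc_succAbove_castSucc, Fin.succ_succAbove_succ]
  exact LinearMap.congr_fun h w

/-- Deleting the end vertices preserves the total coefficient. -/
theorem totalCoeff_clusterBoundary_zero (w : Chain R V 2) :
    totalCoeff R V 1 (clusterBoundary R V 0 w) = totalCoeff R V 0 (stripEnds R V 0 w) := by
  have h : (totalCoeff R V 1).comp (clusterBoundary R V 0) =
      (totalCoeff R V 0).comp (stripEnds R V 0) := by
    refine Finsupp.lhom_ext fun p r => ?_
    simp [totalCoeff, stripEnds, clusterBoundary]
  exact LinearMap.congr_fun h w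

/-- Deleting the end vertices keeps allowed chains allowed. -/
theorem stripEnds_mem_allowed (G : SDigraph V) (k : ℕ) (w : Chain R V (k + 2))
    (hw : w ∈ allowedChains R V G (k + 2)) : stripEnds R V k w ∈ allowedChains R V G k := by
  rw [stripEnds, Finsupp.lsum_apply]
  refine Submodule.sum_mem _ fun p hp => ?_
  intro q hq
  have hq' := Finsupp.support_single_subset hq
  rw [Finset.mem_singleton] at hq'
  subst hq'
  intro i
  exact hw p hp i.succ.castSucc

end

/-- Theorem 5.8(ii): if `(a → b) ∈ E`, the map `π^{[a,b]}` is a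
morphism of chain complexes from `Θ_*^{[a,b]}(G)` to the augmented primitive path chain
complex `Π̃_{*-2}(G)` (in degree `2` the boundary is intertwined with the augmentation). -/
theorem theta_to_augmented_pi_morphism_of_adj
    (R : Type) [CommRing R] (V : Type) [DecidableEq V] [Fintype V]
    (G : SDigraph V) (a b : V) (hab : G.Adj a b) :
    (∀ k : ℕ, (thetaChains R V G a b (k + 2)).map (stripEnds R V k) ≤
      piChains R V G k) ∧
    (∀ w ∈ thetaChains R V G a b 2,
      totalCoeff R V 1 (clusterBoundary R V 0 w) =
        totalCoeff R V 0 (stripEnds R V 0 w)) ∧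
    (∀ k : ℕ, ∀ w ∈ thetaChains R V G a b (k + 3),
      stripEnds R V k (clusterBoundary R V (k + 1) w) =
        boundary R V k (stripEnds R V (k + 1) w)) := by
  refine ⟨?_, fun w _ => totalCoeff_clusterBoundary_zero R V w,
    fun k w _ => stripEnds_clusterBoundary R V k w⟩
  rintro k _ ⟨w, hw, rfl⟩
  cases k with
  | zero => exact stripEnds_mem_allowed R V G 0 w hw.1.1
  | succ k =>
    refine ⟨stripEnds_mem_allowed R V G (k + 1) w hw.1.1, ?_⟩
    change boundary R V k (stripEnds R V (k + 1) w) ∈ allowedChains R V G k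
    rw [← stripEnds_clusterBoundary]
    exact stripEnds_mem_allowed R V G k _ hw.2.1

end PrimitivePath

end
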